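/- A continuous function f : ∂𝔻 × ∂𝔻 → ℂ which is positive definite on Ω₂ × Ω₂, written in its expansion f(ξ,η) = Σ_{m,k∈ℤ} a_{m,k} ξ^m η^k with all a_{m,k} ≥ 0 and Σ a_{m,k} < ∞, is strictly positive definite on Ω₂ × Ω₂ if, and only if, the set {(m,k) ∈ ℤ² : a_{m,k} > 0} intersects every product of full arithmetic progressions in ℤ, i.e. it meets (Nℤ+x) × (Mℤ+y) for every positive integers N, M, x, y. -/

import Mathlib

open scoped ComplexOrder

noncomputable section

/-- The Hilbert space ℓ²(ℂ) of square–summable complex sequences. -/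
abbrev Ell2 : Type := lp (fun _ : ℕ => ℂ) 2

/-- The Hermitian inner product of the paper: `hdot z w = z·w = Σ_j z_j conj(w_j)`. -/
def hdot (z w : Ell2) : ℂ := @inner ℂ _ _ w z

/-- The sphere `Ω_{2q}` (for `q : ℕ∞`), viewed inside ℓ²(ℂ): the unit vectors supported
on the first `q` coordinates; for `q = ⊤` this is the unit sphere `Ω_∞` of ℓ²(ℂ). -/
def Omega (q : ℕ∞) : Set Ell2 :=
  {z | ‖z‖ = 1 ∧ ∀ j : ℕ, q ≤ (j : ℕ∞) → z j = 0}

/-- A kernel `K` is positive definite on a set `S`. -/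
def IsPDKernel {α : Type*} (S : Set α) (K : α → α → ℂ) : Prop :=
  ∀ (L : ℕ) (x : Fin L → α), (∀ i, x i ∈ S) → Function.Injective x →
    ∀ c : Fin L → ℂ, 0 ≤ ∑ μ, ∑ ν, c μ * (starRingEnd ℂ) (c ν) * K (x μ) (x ν)

/-- A kernel `K` is strictly positive definite on a set `S`. -/
def IsSPDKernel {α : Type*} (S : Set α) (K : α → α → ℂ) : Prop :=
  IsPDKernel S K ∧
    ∀ (L : ℕ) (x : Fin L → α), (∀ i, x i ∈ S) → Function.Injective x →
      ∀ c : Fin L → ℂ,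
        ∑ μ, ∑ ν, c μ * (starRingEnd ℂ) (c ν) * K (x μ) (x ν) = 0 → c = 0

/-- `f` is positive definite on `Ω_{2q} × Ω_{2p}`. -/
def PDonProd (q p : ℕ∞) (f : ℂ → ℂ → ℂ) : Prop :=
  IsPDKernel ((Omega q) ×ˢ (Omega p))
    (fun x y => f (hdot x.1 y.1) (hdot x.2 y.2))

/-- `f` is strictly positive definite on `Ω_{2q} × Ω_{2p}`. -/
def SPDonProd (q p : ℕ∞) (f : ℂ → ℂ → ℂ) : Prop :=
  IsSPDKernel ((Omega q) ×ˢ (Omega p))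
    (fun x y => f (hdot x.1 y.1) (hdot x.2 y.2))

/-- `g` is positive definite on `Ω_{2q}`. -/
def PDonSphere (q : ℕ∞) (g : ℂ → ℂ) : Prop :=
  IsPDKernel (Omega q) (fun z z' => g (hdot z z'))

/-- The Jacobi polynomial of degree `k` with (integer) parameters `α, β`, normalized
so that its value at `1` is `1`. -/
def jacobiR (α β k : ℕ) (x : ℝ) : ℝ :=
  (∑ s ∈ Finset.range (k + 1),
      ((k + α).choose (k - s) : ℝ) * ((k + β).choose s : ℝ) *
        ((x - 1) / 2) ^ s * ((x + 1) / 2) ^ (k - s)) /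
    ((k + α).choose k : ℝ)

/-- The disc polynomial `R_{m,n}^{q-2}`; for `q = ⊤` (and also `q = 1`) it is
`ξ^m conj(ξ)^n`.  For `2 ≤ q < ⊤` it equals
`r^{|m-n|} e^{i(m-n)φ} R_{min(m,n)}^{(q-2,|m-n|)}(2r²-1)` for `ξ = r e^{iφ}`. -/
def discR (q : ℕ∞) (m n : ℕ) (ξ : ℂ) : ℂ :=
  if q = ⊤ ∨ q ≤ 1 then ξ ^ m * (starRingEnd ℂ ξ) ^ n
  else (if n ≤ m then ξ ^ (m - n) else (starRingEnd ℂ ξ) ^ (n - m)) *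
    ((jacobiR (q.toNat - 2) (max m n - min m n) (min m n)
        (2 * ‖ξ‖ ^ 2 - 1) : ℝ) : ℂ)

/-- The natural domain `𝔻̃`: the unit circle `∂𝔻` when `q = 1` (the sphere `Ω₂`),
the closed unit disc `𝔻` otherwise. -/
def domD (q : ℕ∞) : Set ℂ :=
  if q = 1 then Metric.sphere (0 : ℂ) 1 else Metric.closedBall (0 : ℂ) 1

/-- `A ⊆ ℤ²` intersects every product of full arithmetic progressions in ℤ. -/
def MeetsAllProgressions (A : Set (ℤ × ℤ)) : Prop :=
  ∀ N M x y : ℤ, 0 < N → 0 < M → 0 < x → 0 < y →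
    ∃ v ∈ A, (∃ j : ℤ, v.1 = N * j + x) ∧ (∃ j : ℤ, v.2 = M * j + y)

theorem Int.isJacobsonRing : IsJacobsonRing ℤ := by
  rw [isJacobsonRing_iff_prime_eq]
  intro P hP
  by_cases h : P = ⊥
  · subst h
    refine le_antisymm (fun x hx => ?_) Ideal.le_jacobson
    have hu := Ideal.mem_jacobson_bot.mp hx (3 * x)
    rw [Int.isUnit_iff] at hu
    rw [Ideal.mem_bot]
    rcases hu with hu | hu <;> nlinarith
  · have := hP.isMaximal h
    exact Ideal.jacobson_eq_self_of_isMaximal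

/-- A field that is finitely generated as a ring is finite. -/
theorem Field.finite_of_finiteType_int (K : Type*) [Field K] [Algebra.FiniteType ℤ K] :
    Finite K := by
  have := Int.isJacobsonRing
  have hfin : Module.Finite ℤ K := finite_of_finite_type_of_isJacobsonRing ℤ K
  have hchar : ringChar K ≠ 0 := by
    intro h0
    have : CharZero K := (CharP.ringChar_zero_iff_CharZero K).mp h0
    have hinj : Function.Injective (algebraMap ℤ K) := by
      simpa using Int.cast_injective (α := K)
    exact Int.not_isField (isField_of_isIntegral_of_isField hinj (Field.toIsField K))
  refine Module.finite_of_fg_torsion K fun x => ⟨⟨(ringChar K : ℤ), ?_⟩, ?_⟩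
  · exact mem_nonZeroDivisors_of_ne_zero (by exact_mod_cast hchar)
  · simp [Submonoid.smul_def]

/-- An exponential sum that is nonzero at `(m, k)` is nonzero on `(m, k) + N ℤ²` for some `N > 0`. -/
theorem exists_period_sum_ne_zero {ι : Type*} [Fintype ι] (c : ι → ℂ) (z w : ι → ℂˣ) (m k : ℤ)
    (h : ∑ μ, c μ * (z μ : ℂ) ^ m * (w μ : ℂ) ^ k ≠ 0) :
    ∃ N : ℕ, 0 < N ∧ ∀ i j : ℤ,
      ∑ μ, c μ * (z μ : ℂ) ^ (m + N * i) * (w μ : ℂ) ^ (k + N * j) ≠ 0 := by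
  classical
  set s := ∑ μ, c μ * (z μ : ℂ) ^ m * (w μ : ℂ) ^ k with hs
  let T : Set ℂ := Set.range c ∪ Set.range (fun μ => (z μ : ℂ)) ∪
    Set.range (fun μ => ((z μ)⁻¹ : ℂ)) ∪ Set.range (fun μ => (w μ : ℂ)) ∪
    Set.range (fun μ => ((w μ)⁻¹ : ℂ)) ∪ {s⁻¹}
  have hT : T.Finite := by
    simp only [T, Set.finite_union, Set.finite_singleton, Set.finite_range, and_self]
  let R : Subalgebra ℤ ℂ := Algebra.adjoin ℤ T
  have hmem : ∀ x ∈ T, x ∈ R := fun x hx => Algebra.subset_adjoin hx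
  have : Algebra.FiniteType ℤ R := .adjoin_of_finite hT
  obtain ⟨I, hI⟩ := Ideal.exists_maximal R
  have hft : Algebra.FiniteType ℤ (R ⧸ I) := inferInstance
  have hF : Finite (R ⧸ I) := by
    let _ : Field (R ⧸ I) := Ideal.Quotient.field I
    exact @Field.finite_of_finiteType_int (R ⧸ I) _ hft
  let _ : Fintype (R ⧸ I) := Fintype.ofFinite _
  let C : ι → R := fun μ => ⟨c μ, hmem _ (by simp [T])⟩
  let Z : ι → Rˣ := fun μ => ⟨⟨z μ, hmem _ (by simp [T])⟩, ⟨(z μ : ℂ)⁻¹, hmem _ (by simp [T])⟩,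
    by ext; simp, by ext; simp⟩
  let W : ι → Rˣ := fun μ => ⟨⟨w μ, hmem _ (by simp [T])⟩, ⟨(w μ : ℂ)⁻¹, hmem _ (by simp [T])⟩,
    by ext; simp, by ext; simp⟩
  have hcoe (u : Rˣ) (n : ℤ) : (((u ^ n : Rˣ) : R) : ℂ) = ((u : R) : ℂ) ^ n := by
    have := congrArg Units.val (map_zpow (Units.map (R.val : R →* ℂ)) u n)
    rwa [Units.val_zpow_eq_zpow_val] at this
  let S : ℤ → ℤ → R := fun m k => ∑ μ, C μ * ((Z μ ^ m : Rˣ) : R) * ((W μ ^ k : Rˣ) : R)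
  have hS (m k : ℤ) : (S m k : ℂ) = ∑ μ, c μ * (z μ : ℂ) ^ m * (w μ : ℂ) ^ k := by
    simp only [S, AddSubmonoidClass.coe_finsetSum, MulMemClass.coe_mul, hcoe]
    rfl
  have hunit : IsUnit (S m k) := by
    refine IsUnit.of_mul_eq_one ⟨s⁻¹, hmem _ (by simp [T])⟩ ?_
    ext
    simp only [MulMemClass.coe_mul, hS, ← hs]
    simpa using mul_inv_cancel₀ h
  have hne : Ideal.Quotient.mk I (S m k) ≠ 0 := (hunit.map _).ne_zero
  refine ⟨Fintype.card (R ⧸ I)ˣ, Fintype.card_pos, fun i j => ?_⟩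
  have hperiod (u : Rˣ) (n i : ℤ) :
      Ideal.Quotient.mk I ((u ^ (n + Fintype.card (R ⧸ I)ˣ * i) : Rˣ) : R) =
        Ideal.Quotient.mk I ((u ^ n : Rˣ) : R) := by
    have : Units.map (Ideal.Quotient.mk I : R →* R ⧸ I)
        (u ^ (n + Fintype.card (R ⧸ I)ˣ * i)) = Units.map (Ideal.Quotient.mk I : R →* R ⧸ I)
        (u ^ n) := by
      rw [zpow_add, zpow_mul, zpow_natCast, map_mul, map_zpow _ (u ^ _), map_pow, pow_card_eq_one,
        one_zpow, mul_one]
    exact congrArg Units.val this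
  rw [← hS]
  intro h0
  apply hne
  have h0' : S (m + Fintype.card (R ⧸ I)ˣ * i) (k + Fintype.card (R ⧸ I)ˣ * j) = 0 := by
    ext; exact h0
  rw [← map_zero (Ideal.Quotient.mk I), ← h0']
  simp only [S, map_sum, map_mul, hperiod]

/-- Distinct characters of `ℤ²` are linearly independent. -/
theorem eq_zero_of_forall_sum_zpow_eq_zero {ι : Type*} [Fintype ι] (c : ι → ℂ) (z w : ι → ℂˣ)
    (hinj : Function.Injective fun μ => (z μ, w μ))
    (h : ∀ m k : ℤ, ∑ μ, c μ * (z μ : ℂ) ^ m * (w μ : ℂ) ^ k = 0) : c = 0 := by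
  let χ : ι → (Multiplicative (ℤ × ℤ) →* ℂ) := fun μ =>
    (Units.coeHom ℂ).comp (AddMonoidHom.toMultiplicativeLeft
      (((zmultiplesHom (Additive ℂˣ)) (Additive.ofMul (z μ))).coprod
        ((zmultiplesHom (Additive ℂˣ)) (Additive.ofMul (w μ)))))
  have hχ (μ : ι) (m k : ℤ) :
      χ μ (Multiplicative.ofAdd (m, k)) = (z μ : ℂ) ^ m * (w μ : ℂ) ^ k := by
    simp [χ]
  have hχinj : Function.Injective χ := by
    intro μ ν hμν
    apply hinj
    have h1 := DFunLike.congr_fun hμν (Multiplicative.ofAdd (1, 0))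
    have h2 := DFunLike.congr_fun hμν (Multiplicative.ofAdd (0, 1))
    rw [hχ, hχ] at h1 h2
    simp only [zpow_one, zpow_zero, mul_one, one_mul] at h1 h2
    exact Prod.ext (Units.ext h1) (Units.ext h2)
  have hlin := (linearIndependent_monoidHom (Multiplicative (ℤ × ℤ)) ℂ).comp χ hχinj
  rw [Fintype.linearIndependent_iff] at hlin
  funext μ
  refine hlin c ?_ μ
  funext g
  refine Eq.trans ?_ (h g.toAdd.1 g.toAdd.2)
  simp only [Finset.sum_apply, Pi.smul_apply, Function.comp_apply, smul_eq_mul, mul_assoc]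
  exact Finset.sum_congr rfl fun μ _ => congrArg _ (hχ μ _ _)

theorem hdot_of_mem_Omega_one {z : Ell2} (hz : z ∈ Omega 1) (w : Ell2) :
    hdot z w = z 0 * (starRingEnd ℂ) (w 0) := by
  rw [hdot, lp.inner_eq_tsum, tsum_eq_single 0]
  · simp
  · intro j hj
    rw [hz.2 j (by exact_mod_cast Nat.one_le_iff_ne_zero.mpr hj)]
    simp

theorem eq_single_of_mem_Omega_one {z : Ell2} (hz : z ∈ Omega 1) :
    z = lp.single 2 0 (z 0) := by
  ext j
  rw [lp.single_apply]
  by_cases hj : j = 0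
  · subst hj; simp
  · rw [hz.2 j (by exact_mod_cast Nat.one_le_iff_ne_zero.mpr hj), Pi.single_eq_of_ne hj]

theorem single_mem_Omega_one (ξ : Circle) : (lp.single 2 0 (ξ : ℂ) : Ell2) ∈ Omega 1 := by
  refine ⟨by rw [lp.norm_single (by norm_num)]; exact Circle.norm_coe ξ, fun j hj => ?_⟩
  have : j ≠ 0 := Nat.one_le_iff_ne_zero.mp (by exact_mod_cast hj)
  exact lp.single_apply_ne 2 0 _ this

/-- The sphere `Omega 1` is the unit circle. -/
def omegaOneEquivCircle : Omega 1 ≃ Circle where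
  toFun z := ⟨(z : Ell2) 0, by
    refine mem_sphere_zero_iff_norm.mpr (Eq.trans ?_ z.2.1)
    conv_rhs => rw [eq_single_of_mem_Omega_one z.2, lp.norm_single (by norm_num)]⟩
  invFun ξ := ⟨lp.single 2 0 (ξ : ℂ), single_mem_Omega_one ξ⟩
  left_inv z := Subtype.ext (eq_single_of_mem_Omega_one z.2).symm
  right_inv ξ := Circle.ext (lp.single_apply_self (E := fun _ : ℕ => ℂ) 2 0 (ξ : ℂ))

theorem hdot_eq_circle (z w : Omega 1) :
    hdot z w = (omegaOneEquivCircle z : ℂ) * (starRingEnd ℂ) (omegaOneEquivCircle w : ℂ) :=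
  hdot_of_mem_Omega_one z.2 w

/-- The quadratic form of a kernel with summable Fourier expansion is a weighted sum of squared
moduli of exponential sums. -/
theorem hasSum_mul_normSq_sum {ι : Type*} [Fintype ι] {f : ℂ → ℂ → ℂ} {a : ℤ × ℤ → ℝ}
    (ha0 : ∀ i, 0 ≤ a i) (haS : Summable a)
    (hexp : ∀ ξ ∈ Metric.sphere (0 : ℂ) 1, ∀ η ∈ Metric.sphere (0 : ℂ) 1,
      f ξ η = ∑' i : ℤ × ℤ, (a i : ℂ) * ξ ^ i.1 * η ^ i.2)
    (z w : ι → Circle) (c : ι → ℂ) :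
    HasSum (fun i : ℤ × ℤ =>
        ((a i * Complex.normSq (∑ μ, c μ * (z μ : ℂ) ^ i.1 * (w μ : ℂ) ^ i.2) : ℝ) : ℂ))
      (∑ μ, ∑ ν, c μ * (starRingEnd ℂ) (c ν) *
        f (z μ * (starRingEnd ℂ) (z ν : ℂ)) (w μ * (starRingEnd ℂ) (w ν : ℂ))) := by
  have hterm (ξ η : Circle) :
      HasSum (fun i : ℤ × ℤ => (a i : ℂ) * (ξ : ℂ) ^ i.1 * (η : ℂ) ^ i.2) (f ξ η) := by
    rw [hexp ξ (mem_sphere_zero_iff_norm.mpr ξ.norm_coe)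
      η (mem_sphere_zero_iff_norm.mpr η.norm_coe)]
    refine (Summable.of_norm ?_).hasSum
    simpa [abs_of_nonneg (ha0 _), Circle.norm_coe] using haS
  have hsum : HasSum (fun i : ℤ × ℤ => ∑ μ, ∑ ν, c μ * (starRingEnd ℂ) (c ν) *
      ((a i : ℂ) * ((z μ / z ν : Circle) : ℂ) ^ i.1 * ((w μ / w ν : Circle) : ℂ) ^ i.2))
      (∑ μ, ∑ ν, c μ * (starRingEnd ℂ) (c ν) *
        f ((z μ / z ν : Circle) : ℂ) ((w μ / w ν : Circle) : ℂ)) :=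
    hasSum_sum fun μ _ => hasSum_sum fun ν _ => (hterm _ _).mul_left _
  have hdiv (ξ η : Circle) : ((ξ / η : Circle) : ℂ) = ξ * (starRingEnd ℂ) (η : ℂ) := by
    rw [div_eq_mul_inv, Circle.coe_mul, Circle.coe_inv_eq_conj]
  simp only [hdiv] at hsum
  convert hsum using 2 with i
  rw [Complex.ofReal_mul, ← Complex.mul_conj, map_sum, Finset.sum_mul_sum, Finset.mul_sum]
  refine Finset.sum_congr rfl fun μ _ => ?_
  rw [Finset.mul_sum]
  refine Finset.sum_congr rfl fun ν _ => ?_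
  simp only [map_mul, map_zpow₀, mul_zpow]
  ring

/-- Strict positive definiteness in terms of exponential sums over the support of the
coefficients. -/
theorem spdOnProd_one_one_iff {f : ℂ → ℂ → ℂ} (hPD : PDonProd 1 1 f) {a : ℤ × ℤ → ℝ}
    (ha0 : ∀ i, 0 ≤ a i) (haS : Summable a)
    (hexp : ∀ ξ ∈ Metric.sphere (0 : ℂ) 1, ∀ η ∈ Metric.sphere (0 : ℂ) 1,
      f ξ η = ∑' i : ℤ × ℤ, (a i : ℂ) * ξ ^ i.1 * η ^ i.2) :
    SPDonProd 1 1 f ↔ ∀ (L : ℕ) (z w : Fin L → Circle),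
      (Function.Injective fun μ => (z μ, w μ)) → ∀ c : Fin L → ℂ,
      (∀ v, 0 < a v → ∑ μ, c μ * (z μ : ℂ) ^ v.1 * (w μ : ℂ) ^ v.2 = 0) → c = 0 := by
  have hzero {L : ℕ} (z w : Fin L → Circle) (c : Fin L → ℂ) :
      ∑ μ, ∑ ν, c μ * (starRingEnd ℂ) (c ν) *
        f (z μ * (starRingEnd ℂ) (z ν : ℂ)) (w μ * (starRingEnd ℂ) (w ν : ℂ)) = 0 ↔
      ∀ v, 0 < a v → ∑ μ, c μ * (z μ : ℂ) ^ v.1 * (w μ : ℂ) ^ v.2 = 0 := by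
    have hsum := hasSum_mul_normSq_sum ha0 haS hexp z w c
    have hiff := hasSum_zero_iff_of_nonneg (L := .unconditional _)
      (fun i => mul_nonneg (ha0 i)
      (Complex.normSq_nonneg (∑ μ, c μ * (z μ : ℂ) ^ i.1 * (w μ : ℂ) ^ i.2)))
    constructor
    · intro h v hv
      rw [h, ← Complex.ofReal_zero, Complex.hasSum_ofReal] at hsum
      have := congrFun (hiff.mp hsum) v
      simpa [hv.ne'] using this
    · intro h
      refine hsum.unique ?_
      rw [← Complex.ofReal_zero, Complex.hasSum_ofReal]
      refine hiff.mpr (funext fun v => ?_)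
      rcases (ha0 v).eq_or_lt with hv | hv
      · simp [← hv]
      · simp [h v hv]
  constructor
  · intro hS L z w hinj c hc
    refine hS.2 L (fun μ => ((omegaOneEquivCircle.symm (z μ) : Ell2),
      (omegaOneEquivCircle.symm (w μ) : Ell2))) (fun μ => ⟨Subtype.prop _, Subtype.prop _⟩) ?_ c ?_
    · intro μ ν h
      apply hinj
      have h := Prod.ext_iff.mp h
      exact Prod.ext (omegaOneEquivCircle.symm.injective (Subtype.ext h.1))
        (omegaOneEquivCircle.symm.injective (Subtype.ext h.2))
    · simpa only [hdot_eq_circle, Equiv.apply_symm_apply] using (hzero z w c).mpr hc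
  · intro h
    refine ⟨hPD, fun L x hx hinj c hc => ?_⟩
    let p : Fin L → Omega 1 := fun μ => ⟨(x μ).1, (hx μ).1⟩
    let q : Fin L → Omega 1 := fun μ => ⟨(x μ).2, (hx μ).2⟩
    refine h L (fun μ => omegaOneEquivCircle (p μ)) (fun μ => omegaOneEquivCircle (q μ)) ?_ c ?_
    · intro μ ν hμν
      have hμν := Prod.ext_iff.mp hμν
      apply hinj
      exact Prod.ext (congrArg Subtype.val (omegaOneEquivCircle.injective hμν.1))
        (congrArg Subtype.val (omegaOneEquivCircle.injective hμν.2))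
    · rw [← hzero]
      simpa only [← hdot_eq_circle] using hc

/-- Orthogonality of the powers of a primitive root of unity. -/
theorem IsPrimitiveRoot.sum_zpow_eq_zero {ζ : ℂ} {N : ℕ} (hζ : IsPrimitiveRoot ζ N) {n : ℤ}
    (hn : ¬ (N : ℤ) ∣ n) : ∑ j : Fin N, (ζ ^ n) ^ (j : ℕ) = 0 := by
  have h1 : ζ ^ n - 1 ≠ 0 := sub_ne_zero.mpr fun h => hn ((hζ.zpow_eq_one_iff_dvd n).mp h)
  have h2 := mul_geom_sum (ζ ^ n) N
  rw [← zpow_natCast, zpow_comm, zpow_natCast, hζ.pow_eq_one, one_zpow, sub_self] at h2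
  rw [Fin.sum_univ_eq_sum_range (fun j => (ζ ^ n) ^ j)]
  exact (mul_eq_zero.mp h2).resolve_left h1

theorem Circle.exists_isPrimitiveRoot (N : ℕ) (hN : 0 < N) :
    ∃ ζ : Circle, IsPrimitiveRoot (ζ : ℂ) N := by
  have h := Complex.isPrimitiveRoot_exp N hN.ne'
  exact ⟨⟨_, mem_sphere_zero_iff_norm.mpr (h.norm'_eq_one hN.ne')⟩, h⟩

/-- Theorem 1.3 / `th_main_11`: a continuous PD function on
`Ω_2 × Ω_2` is SPD if and only if the set `{(m,k) : a_{m,k} > 0}` from its Fourier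
expansion intersects every product of full arithmetic progressions in ℤ. -/
theorem stmt2 (f : ℂ → ℂ → ℂ)
    (hf : ContinuousOn (fun v : ℂ × ℂ => f v.1 v.2)
      (Metric.sphere 0 1 ×ˢ Metric.sphere 0 1))
    (hPD : PDonProd 1 1 f)
    (a : ℤ × ℤ → ℝ) (ha0 : ∀ i, 0 ≤ a i) (haS : Summable a)
    (hexp : ∀ ξ ∈ Metric.sphere (0 : ℂ) 1, ∀ η ∈ Metric.sphere (0 : ℂ) 1,
      f ξ η = ∑' i : ℤ × ℤ, (a i : ℂ) * ξ ^ i.1 * η ^ i.2) :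
    SPDonProd 1 1 f ↔
      MeetsAllProgressions {v : ℤ × ℤ | 0 < a v} := by
  rw [spdOnProd_one_one_iff hPD ha0 haS hexp]
  constructor
  · intro h N M x y hN hM _ _
    lift N to ℕ using hN.le
    lift M to ℕ using hM.le
    have hN' : 0 < N := by exact_mod_cast hN
    have hM' : 0 < M := by exact_mod_cast hM
    obtain ⟨ζ, hζ⟩ := Circle.exists_isPrimitiveRoot N hN'
    obtain ⟨ω, hω⟩ := Circle.exists_isPrimitiveRoot M hM'
    by_contra hA
    let e : Fin (N * M) ≃ Fin N × Fin M := finProdFinEquiv.symm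
    let c : Fin N × Fin M → ℂ := fun p =>
      ((ζ : ℂ) ^ (-x)) ^ (p.1 : ℕ) * ((ω : ℂ) ^ (-y)) ^ (p.2 : ℕ)
    have hc := h (N * M) (fun μ => ζ ^ ((e μ).1 : ℕ)) (fun μ => ω ^ ((e μ).2 : ℕ)) ?_
      (fun μ => c (e μ)) ?_
    · have := congrFun hc (e.symm (⟨0, hN'⟩, ⟨0, hM'⟩))
      simp [c] at this
    · intro μ ν hμν
      have hμν := Prod.ext_iff.mp hμν
      apply e.injective
      refine Prod.ext (Fin.ext ?_) (Fin.ext ?_)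
      · exact hζ.pow_inj (e μ).1.2 (e ν).1.2 (by exact_mod_cast congrArg (Subtype.val : Circle → ℂ) hμν.1)
      · exact hω.pow_inj (e μ).2.2 (e ν).2.2 (by exact_mod_cast congrArg (Subtype.val : Circle → ℂ) hμν.2)
    · intro v hv
      have hsplit : ∑ μ, c (e μ) * ((ζ ^ ((e μ).1 : ℕ) : Circle) : ℂ) ^ v.1 *
          ((ω ^ ((e μ).2 : ℕ) : Circle) : ℂ) ^ v.2 =
          (∑ j : Fin N, ((ζ : ℂ) ^ (v.1 - x)) ^ (j : ℕ)) *
            ∑ l : Fin M, ((ω : ℂ) ^ (v.2 - y)) ^ (l : ℕ) := by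
        rw [Equiv.sum_comp e fun p => c p * ((ζ ^ (p.1 : ℕ) : Circle) : ℂ) ^ v.1 *
          ((ω ^ (p.2 : ℕ) : Circle) : ℂ) ^ v.2, Fintype.sum_prod_type, Finset.sum_mul_sum]
        refine Finset.sum_congr rfl fun j _ => Finset.sum_congr rfl fun l _ => ?_
        have hcomm (ξ : ℂ) (n : ℕ) (i : ℤ) : (ξ ^ n) ^ i = (ξ ^ i) ^ n := by
          rw [← zpow_natCast, ← zpow_natCast, zpow_comm]
        simp only [c, Circle.coe_pow, hcomm]
        rw [sub_eq_neg_add, sub_eq_neg_add, zpow_add₀ ζ.coe_ne_zero, zpow_add₀ ω.coe_ne_zero,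
          mul_pow, mul_pow]
        ring
      rw [hsplit]
      by_cases h1 : (N : ℤ) ∣ v.1 - x
      · by_cases h2 : (M : ℤ) ∣ v.2 - y
        · obtain ⟨i, hi⟩ := h1
          obtain ⟨j, hj⟩ := h2
          exact absurd ⟨v, hv, ⟨i, by linarith⟩, ⟨j, by linarith⟩⟩ hA
        · rw [hω.sum_zpow_eq_zero h2, mul_zero]
      · rw [hζ.sum_zpow_eq_zero h1, zero_mul]
  · intro hA L z w hinj c hc
    by_contra hc0
    have hne : ∃ m k : ℤ, ∑ μ, c μ * (z μ : ℂ) ^ m * (w μ : ℂ) ^ k ≠ 0 := by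
      by_contra! hall
      refine hc0 (eq_zero_of_forall_sum_zpow_eq_zero c (fun μ => Circle.toUnits (z μ))
        (fun μ => Circle.toUnits (w μ)) (fun μ ν hμν => hinj ?_) hall)
      have hμν := Prod.ext_iff.mp hμν
      exact Prod.ext (Circle.ext (congrArg Units.val hμν.1))
        (Circle.ext (congrArg Units.val hμν.2))
    obtain ⟨m, k, hmk⟩ := hne
    obtain ⟨N, hN, hnv⟩ := exists_period_sum_ne_zero c (fun μ => Circle.toUnits (z μ))
      (fun μ => Circle.toUnits (w μ)) m k hmk
    have hN1 : (1 : ℤ) ≤ N := by exact_mod_cast hN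
    have hpos (n : ℤ) : 0 < n + N * (|n| + 1) := by
      nlinarith [neg_abs_le n, abs_nonneg n]
    obtain ⟨v, hv, ⟨i, hi⟩, ⟨j, hj⟩⟩ := hA N N _ _ (by omega) (by omega) (hpos m) (hpos k)
    refine hnv (i + (|m| + 1)) (j + (|k| + 1)) ?_
    rw [← hc v hv, hi, hj]
    refine Finset.sum_congr rfl fun μ _ => ?_
    congr 2
    · congr 1; ring
    · ring

end
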